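/- Let G be a finite simple graph, Γ ⊆ Ω(G), and let Γ' be a nonempty subfamily of MaxCritIndep(G) such that for every A ∈ Γ' there exists S ∈ Γ with A ⊆ S. If ⋂Γ is a critical set, then Γ' ◁ Γ, i.e., ⋃Γ' ⊆ ⋃Γ and ⋂Γ ⊆ ⋂Γ'. -/

import Mathlib

/-- `S` is an independent set in `G`: no two of its vertices are adjacent. -/
def IndepSet {V : Type*} (G : SimpleGraph V) (S : Set V) : Prop :=
  ∀ ⦃u⦄, u ∈ S → ∀ ⦃v⦄, v ∈ S → ¬G.Adj u v

/-- The independence number `α(G)`. -/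
noncomputable def indNum {V : Type*} (G : SimpleGraph V) : ℕ :=
  sSup {n : ℕ | ∃ S : Set V, IndepSet G S ∧ S.ncard = n}

/-- `Ω(G)`: the family of maximum independent sets of `G`. -/
def maxIndepFam {V : Type*} (G : SimpleGraph V) : Set (Set V) :=
  {S | IndepSet G S ∧ S.ncard = indNum G}

/-- `N(X)`: the neighborhood of a set of vertices. -/
def nbhd {V : Type*} (G : SimpleGraph V) (X : Set V) : Set V :=
  {v | ∃ x ∈ X, G.Adj v x}

/-- `N[X] = N(X) ∪ X`: the closed neighborhood of a set of vertices. -/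
def closedNbhd {V : Type*} (G : SimpleGraph V) (X : Set V) : Set V :=
  nbhd G X ∪ X

/-- The difference `d(X) = |X| - |N(X)|`. -/
noncomputable def diffd {V : Type*} (G : SimpleGraph V) (X : Set V) : ℤ :=
  (X.ncard : ℤ) - ((nbhd G X).ncard : ℤ)

/-- The critical difference `d(G) = max {d(X) : X ⊆ V(G)}`. -/
noncomputable def critDiff {V : Type*} (G : SimpleGraph V) : ℤ :=
  sSup {d : ℤ | ∃ X : Set V, diffd G X = d}

/-- `X` is a critical set if `d(X) = d(G)`. -/
def IsCritical {V : Type*} (G : SimpleGraph V) (X : Set V) : Prop :=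
  diffd G X = critDiff G

/-- `MaxCritIndep(G)`: the family of critical independent sets of maximum cardinality. -/
def maxCritIndepFam {V : Type*} (G : SimpleGraph V) : Set (Set V) :=
  {S | IndepSet G S ∧ IsCritical G S ∧
    ∀ T : Set V, IndepSet G T → IsCritical G T → T.ncard ≤ S.ncard}

/-- The critical independence number `α'(G)`. -/
noncomputable def critIndNum {V : Type*} (G : SimpleGraph V) : ℕ :=
  sSup {n : ℕ | ∃ S : Set V, IndepSet G S ∧ IsCritical G S ∧ S.ncard = n}

/-- `ker(G)`: the intersection of all critical independent sets. -/
def kerSet {V : Type*} (G : SimpleGraph V) : Set V :=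
  ⋂₀ {A : Set V | IndepSet G A ∧ IsCritical G A}

/-- `nucleus(G)`: the intersection of all maximum critical independent sets. -/
def nucleus {V : Type*} (G : SimpleGraph V) : Set V :=
  ⋂₀ maxCritIndepFam G

/-- `diadem(G)`: the union of all maximum critical independent sets. -/
def diadem {V : Type*} (G : SimpleGraph V) : Set V :=
  ⋃₀ maxCritIndepFam G

/-- `core(G)`: the intersection of all maximum independent sets. -/
def coreSet {V : Type*} (G : SimpleGraph V) : Set V :=
  ⋂₀ maxIndepFam G

/-- `corona(G)`: the union of all maximum independent sets. -/
def coronaSet {V : Type*} (G : SimpleGraph V) : Set V :=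
  ⋃₀ maxIndepFam G

/-- A matching in `G`: a set of pairwise non-incident edges of `G`. -/
def IsMatchingSet {V : Type*} (G : SimpleGraph V) (M : Set (Sym2 V)) : Prop :=
  M ⊆ G.edgeSet ∧ M.Pairwise fun e f => ∀ v, v ∈ e → v ∉ f

/-- The matching number `μ(G)`. -/
noncomputable def matchNum {V : Type*} (G : SimpleGraph V) : ℕ :=
  sSup {n : ℕ | ∃ M : Set (Sym2 V), IsMatchingSet G M ∧ M.ncard = n}

/-- `G` is a König-Egerváry graph if `α(G) + μ(G) = |V(G)|`. -/
def IsKonigEgervary {V : Type*} (G : SimpleGraph V) : Prop :=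
  indNum G + matchNum G = Nat.card V

/-- `Γ` is a König-Egerváry collection: a family of independent sets with
`|⋂Γ| + |⋃Γ| = 2α(G)`. -/
def IsKECollection {V : Type*} (G : SimpleGraph V) (Γ : Set (Set V)) : Prop :=
  (∀ S ∈ Γ, IndepSet G S) ∧ (⋂₀ Γ).ncard + (⋃₀ Γ).ncard = 2 * indNum G

theorem nbhd_union {V : Type*} (G : SimpleGraph V) (X Y : Set V) :
    nbhd G (X ∪ Y) = nbhd G X ∪ nbhd G Y := by
  ext v
  simp only [nbhd, Set.mem_union, Set.mem_ofPred_eq, or_and_right, exists_or]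

theorem nbhd_inter_subset {V : Type*} (G : SimpleGraph V) (X Y : Set V) :
    nbhd G (X ∩ Y) ⊆ nbhd G X ∩ nbhd G Y := by
  rintro v ⟨x, ⟨hX, hY⟩, h⟩
  exact ⟨⟨x, hX, h⟩, ⟨x, hY, h⟩⟩

/-- The difference function is supermodular. -/
theorem diffd_add_le {V : Type*} [Finite V] (G : SimpleGraph V) (X Y : Set V) :
    diffd G X + diffd G Y ≤ diffd G (X ∪ Y) + diffd G (X ∩ Y) := by
  have h₁ := Set.ncard_union_add_ncard_inter X Y
  have h₂ := Set.ncard_union_add_ncard_inter (nbhd G X) (nbhd G Y)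
  have h₃ := Set.ncard_le_ncard (nbhd_inter_subset G X Y)
  simp only [diffd, nbhd_union]
  omega

theorem diffd_le_critDiff {V : Type*} [Finite V] (G : SimpleGraph V) (X : Set V) :
    diffd G X ≤ critDiff G := by
  exact le_csSup (Set.finite_range (diffd G)).bddAbove ⟨X, rfl⟩

theorem IsCritical.union {V : Type*} [Finite V] {G : SimpleGraph V} {X Y : Set V}
    (hX : IsCritical G X) (hY : IsCritical G Y) : IsCritical G (X ∪ Y) := by
  have h₁ := diffd_add_le G X Y
  have h₂ := diffd_le_critDiff G (X ∪ Y)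
  have h₃ := diffd_le_critDiff G (X ∩ Y)
  unfold IsCritical at *
  omega

theorem IndepSet.mono {V : Type*} {G : SimpleGraph V} {S T : Set V}
    (hT : IndepSet G T) (h : S ⊆ T) : IndepSet G S :=
  fun _ hu _ hv => hT (h hu) (h hv)

/-- If `Γ ⊆ Ω(G)`, `Γ'` is a nonempty subfamily of `MaxCritIndep(G)` such
that every `A ∈ Γ'` is contained in some `S ∈ Γ`, and `⋂Γ` is a critical set, then
`Γ' ◁ Γ`, i.e. `⋃Γ' ⊆ ⋃Γ` and `⋂Γ ⊆ ⋂Γ'`. -/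
theorem stmt7 {V : Type*} [Fintype V] (G : SimpleGraph V)
    (Γ Γ' : Set (Set V)) (hΓ : Γ ⊆ maxIndepFam G)
    (hne' : Γ'.Nonempty) (hΓ' : Γ' ⊆ maxCritIndepFam G)
    (hcov : ∀ A ∈ Γ', ∃ S ∈ Γ, A ⊆ S)
    (hcrit : IsCritical G (⋂₀ Γ)) :
    ⋃₀ Γ' ⊆ ⋃₀ Γ ∧ ⋂₀ Γ ⊆ ⋂₀ Γ' := by
  constructor
  · refine Set.sUnion_subset fun A hA => ?_
    obtain ⟨S, hS, hAS⟩ := hcov A hA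
    exact hAS.trans (Set.subset_sUnion_of_mem hS)
  · refine Set.subset_sInter fun A hA => ?_
    obtain ⟨S, hS, hAS⟩ := hcov A hA
    obtain ⟨-, hAcrit, hAmax⟩ := hΓ' hA
    have hind : IndepSet G (A ∪ ⋂₀ Γ) :=
      (hΓ hS).1.mono (Set.union_subset hAS (Set.sInter_subset_of_mem hS))
    have heq : A = A ∪ ⋂₀ Γ :=
      Set.eq_of_subset_of_ncard_le Set.subset_union_left (hAmax _ hind (hAcrit.union hcrit))
    exact Set.union_eq_left.mp heq.symm
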